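/- Let $e_1=(1,0,0)^\top\in\mathbb{R}^3$, let $R\in SO(3)$ be a rotation matrix ($R^\top R=I_3$, $\det R=1$), and let $\|\cdot\|$ be the Euclidean norm on $\mathbb{R}^3$. For $p\in\mathbb{R}^3$ put $A(p)=3pp^\top-\|p\|^2I_3$, and for $p\neq 0$ let $$h(p)=\frac{1}{4\pi\|p\|^5}\,A(p)\,R\,e_1$$ be the dipole magnetic field. Let $M=R\,e_1e_1^\top R^\top$, and define the nominal conditioned intensity by $$h_n(p)=\frac{(4\pi)^{1/3}\,\|p\|}{\left(1+3\,\frac{p^\top Mp}{\|p\|^2}\right)^{1/6}}\quad(p\neq 0),\qquad h_n(0)=0.$$ Then the inverse-cube-root conditioning of the nominal intensity equals the nominal conditioned intensity map: for every $p\in\mathbb{R}^3$ with $p\neq 0$, one has $h(p)\neq 0$ and $\|h(p)\|^{-1/3}=h_n(p)$, i.e. $$\frac{1}{\sqrt[3]{\|h(p)\|}}=\frac{(4\pi)^{1/3}\,\|p\|}{\left(1+3\,\frac{p^\top Mp}{\|p\|^2}\right)^{1/6}};$$ moreover this expression is well defined, since $1\le 1+3\,\frac{p^\top Mp}{\|p\|^2}\le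 4$. -/

import Mathlib

open Matrix

noncomputable section

namespace Dipole

/-- Euclidean space `ℝ³`. -/
abbrev E3 : Type := EuclideanSpace ℝ (Fin 3)

/-- `e₁ = (1,0,0)ᵀ`. -/
def e1 : Fin 3 → ℝ := ![1, 0, 0]

/-- `A(p) = 3 p pᵀ − ‖p‖² I₃`. -/
def A (p : E3) : Matrix (Fin 3) (Fin 3) ℝ :=
  (3 : ℝ) • vecMulVec p.ofLp p.ofLp - ‖p‖ ^ 2 • (1 : Matrix (Fin 3) (Fin 3) ℝ)

/-- The dipole magnetic field `h(p) = (1/(4π‖p‖⁵)) A(p) R e₁`, meaningful for `p ≠ 0`.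
Here `R` rotates the coordinates of the transmitter frame into those of the frame
in which `p` is expressed, so that `R e₁` is the direction of the dipole. -/
def h (R : Matrix (Fin 3) (Fin 3) ℝ) (p : E3) : E3 :=
  WithLp.toLp 2 ((1 / (4 * Real.pi * ‖p‖ ^ 5)) • (A p *ᵥ (R *ᵥ e1)))

/-- `M = Qᵀ e₁ e₁ᵀ Q` where `Q = Rᵀ` is the inverse of the rotation `R` that enters `h`;
that is, `M = R e₁ e₁ᵀ Rᵀ`. -/
def M (R : Matrix (Fin 3) (Fin 3) ℝ) : Matrix (Fin 3) (Fin 3) ℝ :=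
  R * vecMulVec e1 e1 * Rᵀ

/-- The quantity `1 + 3 pᵀMp/‖p‖²`, meaningful for `p ≠ 0`. -/
def radicand (R : Matrix (Fin 3) (Fin 3) ℝ) (p : E3) : ℝ :=
  1 + 3 * (p.ofLp ⬝ᵥ (M R *ᵥ p.ofLp)) / ‖p‖ ^ 2

open Classical in
/-- The nominal conditioned intensity
`h_n(p) = (4π)^{1/3} ‖p‖ / (1 + 3 pᵀMp/‖p‖²)^{1/6}` for `p ≠ 0`, and `h_n(0) = 0`. -/
def hn (R : Matrix (Fin 3) (Fin 3) ℝ) (p : E3) : ℝ :=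
  if p = 0 then 0
  else (4 * Real.pi) ^ ((1 : ℝ) / 3) * ‖p‖ / radicand R p ^ ((1 : ℝ) / 6)

end Dipole

end

namespace Dipole

/-- A rotated unit vector `R e₁` has unit length. -/
theorem dotProduct_mulVec_e1_self {R : Matrix (Fin 3) (Fin 3) ℝ}
    (hR : R ∈ Matrix.specialOrthogonalGroup (Fin 3) ℝ) :
    (R *ᵥ e1) ⬝ᵥ (R *ᵥ e1) = 1 := by
  have h1 : Rᵀ * R = 1 :=
    (Matrix.mem_orthogonalGroup_iff' (Fin 3) ℝ).1 (Matrix.mem_specialOrthogonalGroup_iff.1 hR).1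
  rw [Matrix.dotProduct_mulVec, ← Matrix.mulVec_transpose, Matrix.mulVec_mulVec, h1,
    Matrix.one_mulVec]
  simp [e1, dotProduct, Fin.sum_univ_three]

theorem norm_sq_eq_dotProduct (p : E3) : ‖p‖ ^ 2 = p.ofLp ⬝ᵥ p.ofLp := by
  simp only [EuclideanSpace.real_norm_sq_eq, dotProduct, ← sq]

theorem dotProduct_M_mulVec (R : Matrix (Fin 3) (Fin 3) ℝ) (v : Fin 3 → ℝ) :
    v ⬝ᵥ (M R *ᵥ v) = (v ⬝ᵥ (R *ᵥ e1)) ^ 2 := by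
  rw [M, ← Matrix.mulVec_mulVec, ← Matrix.mulVec_mulVec, Matrix.vecMulVec_mulVec,
    Matrix.mulVec_smul, dotProduct_smul, Matrix.mulVec_transpose, dotProduct_comm e1,
    ← Matrix.dotProduct_mulVec, op_smul_eq_smul, smul_eq_mul, sq]

theorem A_mulVec (p : E3) (u : Fin 3 → ℝ) :
    A p *ᵥ u = (3 * (p.ofLp ⬝ᵥ u)) • p.ofLp - ‖p‖ ^ 2 • u := by
  rw [A, Matrix.sub_mulVec, Matrix.smul_mulVec, Matrix.smul_mulVec, Matrix.one_mulVec,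
    Matrix.vecMulVec_mulVec, op_smul_eq_smul, smul_smul]

/-- For a unit vector `u`, `‖A(p) u‖² = ‖p‖² (‖p‖² + 3 (p·u)²)`. -/
theorem dotProduct_A_mulVec_self (p : E3) {u : Fin 3 → ℝ} (hu : u ⬝ᵥ u = 1) :
    (A p *ᵥ u) ⬝ᵥ (A p *ᵥ u) = ‖p‖ ^ 2 * (‖p‖ ^ 2 + 3 * (p.ofLp ⬝ᵥ u) ^ 2) := by
  rw [A_mulVec]
  simp only [sub_dotProduct, dotProduct_sub, smul_dotProduct, dotProduct_smul, smul_eq_mul, hu,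
    ← norm_sq_eq_dotProduct, dotProduct_comm u p.ofLp]
  ring

theorem one_le_radicand (R : Matrix (Fin 3) (Fin 3) ℝ) (p : E3) : 1 ≤ radicand R p := by
  rw [radicand, dotProduct_M_mulVec]
  have : 0 ≤ 3 * (p.ofLp ⬝ᵥ (R *ᵥ e1)) ^ 2 / ‖p‖ ^ 2 := by positivity
  linarith

theorem radicand_le_four {R : Matrix (Fin 3) (Fin 3) ℝ}
    (hR : R ∈ Matrix.specialOrthogonalGroup (Fin 3) ℝ) (p : E3) : radicand R p ≤ 4 := by
  have hcs : (p.ofLp ⬝ᵥ (R *ᵥ e1)) ^ 2 ≤ ‖p‖ ^ 2 := by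
    have := Finset.sum_mul_sq_le_sq_mul_sq Finset.univ p.ofLp (R *ᵥ e1)
    have hu := dotProduct_mulVec_e1_self hR
    simp only [dotProduct, ← sq] at hu
    rwa [hu, mul_one, ← EuclideanSpace.real_norm_sq_eq] at this
  have : (p.ofLp ⬝ᵥ (R *ᵥ e1)) ^ 2 / ‖p‖ ^ 2 ≤ 1 := div_le_one_of_le₀ hcs (by positivity)
  rw [radicand, dotProduct_M_mulVec, mul_div_assoc]
  linarith

/-- The intensity of the dipole field: `‖h(p)‖ = √(1 + 3 pᵀMp/‖p‖²) / (4π‖p‖³)`. -/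
theorem norm_h {R : Matrix (Fin 3) (Fin 3) ℝ}
    (hR : R ∈ Matrix.specialOrthogonalGroup (Fin 3) ℝ) {p : E3} (hp : p ≠ 0) :
    ‖h R p‖ = √(radicand R p) / (4 * Real.pi * ‖p‖ ^ 3) := by
  have hn : 0 < ‖p‖ := norm_pos_iff.2 hp
  have hpi := Real.pi_pos
  have hr : 0 ≤ radicand R p := zero_le_one.trans (one_le_radicand R p)
  rw [← sq_eq_sq₀ (norm_nonneg _) (by positivity), norm_sq_eq_dotProduct, div_pow,
    Real.sq_sqrt hr, h, smul_dotProduct, dotProduct_smul,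
    dotProduct_A_mulVec_self p (dotProduct_mulVec_e1_self hR), radicand, dotProduct_M_mulVec,
    smul_eq_mul, smul_eq_mul]
  field_simp

/-- The inverse cube root of `√r / (4π n³)`. -/
theorem one_div_rpow_sqrt_div {r n : ℝ} (hr : 0 ≤ r) (hn : 0 ≤ n) :
    1 / (√r / (4 * Real.pi * n ^ 3)) ^ ((1 : ℝ) / 3) =
      (4 * Real.pi) ^ ((1 : ℝ) / 3) * n / r ^ ((1 : ℝ) / 6) := by
  have hpi := Real.pi_pos
  have hcube : (n ^ 3) ^ ((1 : ℝ) / 3) = n := by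
    rw [← Real.rpow_natCast, ← Real.rpow_mul hn]
    norm_num
  rw [Real.div_rpow (Real.sqrt_nonneg _) (by positivity),
    Real.mul_rpow (by positivity) (by positivity), hcube, Real.sqrt_eq_rpow, ← Real.rpow_mul hr,
    one_div_div]
  norm_num

end Dipole

/-- For `R ∈ SO(3)` and `p ≠ 0`, the field `h(p)` does not vanish, `‖h(p)‖^{-1/3} = h_n(p)`, i.e.
`1/∛‖h(p)‖ = (4π)^{1/3} ‖p‖ / (1 + 3 pᵀMp/‖p‖²)^{1/6}`, and `1 ≤ 1 + 3 pᵀMp/‖p‖² ≤ 4`. -/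
theorem conditioned_intensity_formula
    (R : Matrix (Fin 3) (Fin 3) ℝ) (hR : R ∈ Matrix.specialOrthogonalGroup (Fin 3) ℝ)
    (p : EuclideanSpace ℝ (Fin 3)) (hp : p ≠ 0) :
    Dipole.h R p ≠ 0 ∧
    ‖Dipole.h R p‖ ^ (-(1 : ℝ) / 3) = Dipole.hn R p ∧
    1 / ‖Dipole.h R p‖ ^ ((1 : ℝ) / 3) =
      (4 * Real.pi) ^ ((1 : ℝ) / 3) * ‖p‖ /
        (1 + 3 * (p.ofLp ⬝ᵥ (Dipole.M R *ᵥ p.ofLp)) / ‖p‖ ^ 2) ^ ((1 : ℝ) / 6) ∧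
    1 ≤ 1 + 3 * (p.ofLp ⬝ᵥ (Dipole.M R *ᵥ p.ofLp)) / ‖p‖ ^ 2 ∧
    1 + 3 * (p.ofLp ⬝ᵥ (Dipole.M R *ᵥ p.ofLp)) / ‖p‖ ^ 2 ≤ 4 := by
  have hr : 0 < Dipole.radicand R p := one_pos.trans_le (Dipole.one_le_radicand R p)
  have hformula := Dipole.one_div_rpow_sqrt_div hr.le (norm_nonneg p)
  rw [← Dipole.norm_h hR hp] at hformula
  refine ⟨?_, ?_, hformula, Dipole.one_le_radicand R p, Dipole.radicand_le_four hR p⟩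
  · have hn : 0 < ‖p‖ := norm_pos_iff.2 hp
    have hpi := Real.pi_pos
    rw [← norm_pos_iff, Dipole.norm_h hR hp]
    positivity
  · rw [Dipole.hn, if_neg hp, ← hformula, neg_div, Real.rpow_neg (norm_nonneg _), one_div (_ ^ _)]
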